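/- Let E be a finite-dimensional real inner product space, let 1 ≤ q < ∞ be a real number, and define g : E → ℝ by g(z) := ((1 + ‖z‖²)^{1/2} − 1)^q. Then g is twice continuously differentiable on E and there exists a constant Λ_q > 0 such that the second Fréchet derivative of g satisfies ‖D²g(z)‖ ≤ Λ_q (1 + ‖z‖)^{q−2} for all z ∈ E, where ‖D²g(z)‖ denotes the operator norm of the second derivative as a continuous bilinear map E × E → ℝ. -/

import Mathlib

namespace AngleQ

set_option linter.unusedSectionVars false

variable {E : Type*} [NormedAddCommGroup E] [InnerProductSpace ℝ E]

noncomputable def L (E : Type*) [NormedAddCommGroup E] [InnerProductSpace ℝ E] :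
    E →L[ℝ] E →L[ℝ] ℝ := innerSL ℝ

noncomputable def s (z : E) : ℝ := Real.sqrt (1 + ‖z‖ ^ 2)

lemma s_sq (z : E) : s z ^ 2 = 1 + ‖z‖ ^ 2 := Real.sq_sqrt (by positivity)

lemma one_le_s (z : E) : 1 ≤ s z := by
  unfold s; rw [Real.one_le_sqrt]; nlinarith [sq_nonneg ‖z‖]

lemma s_pos (z : E) : 0 < s z := lt_of_lt_of_le one_pos (one_le_s z)

lemma s_gt (z : E) (hz : z ≠ 0) : 1 < s z := by
  have := norm_pos_iff.mpr hz
  nlinarith [s_sq z, one_le_s z, pow_pos this 2]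

lemma s_zero : s (0 : E) = 1 := by simp [s]

lemma s_le (z : E) : s z ≤ 1 + ‖z‖ := by
  nlinarith [s_sq z, one_le_s z, norm_nonneg z]

lemma le_s (z : E) : 1 + ‖z‖ ≤ 2 * s z := by
  nlinarith [s_sq z, one_le_s z, norm_nonneg z]

lemma s_cont : Continuous (s : E → ℝ) := by unfold s; fun_prop

lemma hasFDerivAt_s (z : E) : HasFDerivAt (s : E → ℝ) ((s z)⁻¹ • L E z) z := by
  have h1 : HasFDerivAt (fun z : E => 1 + ‖z‖ ^ 2) (2 • L E z) z :=
    ((hasStrictFDerivAt_norm_sq z).hasFDerivAt).const_add 1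
  have h2 := h1.sqrt (by positivity)
  refine h2.congr_fderiv ?_
  ext v
  have := (s_pos z).ne'
  simp only [_root_.smul_apply, smul_eq_mul, nsmul_eq_mul]
  change 1 / (2 * s z) * _ = _
  field_simp
  norm_num

noncomputable def φ (q : ℝ) (z : E) : ℝ := q * (s z - 1) ^ (q - 1) / s z

noncomputable def ψ (q : ℝ) (z : E) : ℝ :=
  q * ((q - 1) * (s z - 1) ^ (q - 2) / s z ^ 2 - (s z - 1) ^ (q - 1) / s z ^ 3)

noncomputable def χ (q : ℝ) (z : E) : ℝ :=
  q * ((q - 1) * (s z - 1) ^ (q - 1) * (s z + 1) / s z ^ 2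
    + (s z - 1) ^ (q - 1) * (s z - 1) * (s z + 1) / s z ^ 3)

noncomputable def H (q : ℝ) (z : E) : E →L[ℝ] E →L[ℝ] ℝ :=
  φ q z • L E + (ψ q z • L E z).smulRight (L E z)

lemma rpow_cont (q : ℝ) (hq : 1 ≤ q) : Continuous (fun z : E => (s z - 1) ^ (q - 1)) :=
  (s_cont.sub continuous_const).rpow_const (fun _ => Or.inr (by linarith))

lemma φ_cont (q : ℝ) (hq : 1 ≤ q) : Continuous (φ q : E → ℝ) :=
  (continuous_const.mul (rpow_cont q hq)).div s_cont (fun z => (s_pos z).ne')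

lemma χ_cont (q : ℝ) (hq : 1 ≤ q) : Continuous (χ q : E → ℝ) := by
  have h := rpow_cont (E := E) q hq
  have hs := s_cont (E := E)
  have h0 : ∀ z : E, s z ^ 2 ≠ 0 := fun z => (pow_pos (s_pos z) 2).ne'
  have h0' : ∀ z : E, s z ^ 3 ≠ 0 := fun z => (pow_pos (s_pos z) 3).ne'
  unfold χ
  fun_prop (disch := assumption)

lemma hasFDerivAt_g (q : ℝ) (hq : 1 ≤ q) (z : E) :
    HasFDerivAt (fun z : E => (Real.sqrt (1 + ‖z‖ ^ 2) - 1) ^ q) (φ q z • L E z) z := by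
  have h := ((hasFDerivAt_s z).sub_const 1).rpow_const (p := q) (Or.inr hq)
  refine h.congr_fderiv ?_
  rw [smul_smul]; rfl

lemma hasFDerivAt_φ (q : ℝ) (z : E) (hz : z ≠ 0) :
    HasFDerivAt (φ q : E → ℝ) (ψ q z • L E z) z := by
  have hne : s z - 1 ≠ 0 := (sub_pos.mpr (s_gt z hz)).ne'
  have h1 := ((hasFDerivAt_s z).sub_const 1).rpow_const (p := q - 1) (Or.inl hne)
  have h2 : HasDerivAt (fun x : ℝ => q * (x - 1) ^ (q - 1) / x)
      ((q * (1 * (q - 1) * (s z - 1) ^ (q - 1 - 1)) * s z - q * (s z - 1) ^ (q - 1) * 1)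
        / s z ^ 2) (s z) :=
    (((((hasDerivAt_id (s z)).sub_const 1).rpow_const (Or.inl hne)).const_mul q).div
      (hasDerivAt_id (s z)) (s_pos z).ne')
  have h3 := h2.comp_hasFDerivAt z (hasFDerivAt_s z)
  refine h3.congr_fderiv ?_
  rw [smul_smul]
  congr 1
  have := (s_pos z).ne'
  rw [show q - 1 - 1 = q - 2 by ring]
  unfold ψ
  field_simp

lemma hasFDerivAt_G (q : ℝ) (hq : 1 ≤ q) (z : E) :
    HasFDerivAt (fun z : E => φ q z • L E z) (H q z) z := by
  by_cases hz : z = 0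
  · subst hz
    have hH : H q (0 : E) = φ q (0 : E) • L E := by
      ext v w; simp [H]
    rw [hH, hasFDerivAt_iff_isLittleO_nhds_zero]
    have h1 : (fun h : E => φ q h - φ q (0 : E)) =o[nhds 0] (fun _ => (1 : ℝ)) := by
      rw [Asymptotics.isLittleO_one_iff]
      have := ((φ_cont (E := E) q hq).tendsto 0).sub_const (φ q (0 : E))
      simpa using this
    have h2 : (fun h : E => L E h) =O[nhds 0] (fun h : E => h) :=
      (L E).isBigO_id _
    have h3 := h1.smul_isBigO h2
    have h4 : (fun h : E => (1 : ℝ) • h) = fun h => h := by simp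
    rw [h4] at h3
    refine h3.congr_left ?_
    intro h
    simp [sub_smul]
  · exact (hasFDerivAt_φ q z hz).smul (L E).hasFDerivAt

lemma norm_L (z : E) : ‖L E z‖ = ‖z‖ := innerSL_apply_norm (𝕜 := ℝ) z

lemma norm_L_le : ‖L E‖ ≤ 1 :=
  ContinuousLinearMap.opNorm_le_bound _ zero_le_one (fun z => by rw [norm_L, one_mul])

lemma χ_nonneg (q : ℝ) (hq : 1 ≤ q) (z : E) : 0 ≤ χ q z := by
  have h1 := s_pos z
  have h2 : 0 ≤ s z - 1 := by linarith [one_le_s z]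
  have h3 : 0 ≤ q - 1 := by linarith
  have h4 : 0 ≤ q := by linarith
  unfold χ; positivity

lemma norm_T_le (q : ℝ) (hq : 1 ≤ q) (z : E) :
    ‖(ψ q z • L E z).smulRight (L E z)‖ ≤ χ q z := by
  by_cases hz : z = 0
  · subst hz
    have h0 : (ψ q (0 : E) • L E 0).smulRight (L E (0 : E)) = 0 := by ext v w; simp
    rw [h0]
    exact (norm_zero (E := E →L[ℝ] E →L[ℝ] ℝ)).le.trans (χ_nonneg q hq (0 : E))
  rw [ContinuousLinearMap.norm_smulRight_apply, norm_smul, norm_L, mul_assoc]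
  have h1 := s_pos z
  have h2 : 0 < s z - 1 := by linarith [s_gt z hz]
  have h3 : 0 ≤ q - 1 := by linarith
  have h4 : 0 ≤ q := by linarith
  have h5 : ‖z‖ * ‖z‖ = (s z - 1) * (s z + 1) := by nlinarith [s_sq z]
  have h6 : (s z - 1) ^ (q - 1) = (s z - 1) ^ (q - 2) * (s z - 1) := by
    rw [← Real.rpow_add_one h2.ne']; congr 1; ring
  have h7 : ‖ψ q z‖ ≤
      q * ((q - 1) * (s z - 1) ^ (q - 2) / s z ^ 2 + (s z - 1) ^ (q - 1) / s z ^ 3) := by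
    unfold ψ
    rw [norm_mul, Real.norm_of_nonneg h4]
    gcongr
    refine (norm_sub_le _ _).trans (le_of_eq ?_)
    rw [Real.norm_of_nonneg (by positivity), Real.norm_of_nonneg (by positivity)]
  rw [h5]
  refine (mul_le_mul_of_nonneg_right h7 (by positivity)).trans (le_of_eq ?_)
  unfold χ
  rw [h6]; field_simp

lemma χ_zero (q : ℝ) : χ q (0 : E) = 0 := by
  unfold χ
  rw [s_zero]
  by_cases h : q - 1 = 0
  · simp [h]
  · simp [Real.zero_rpow h]

set_option maxSynthPendingDepth 6 in
lemma H_cont (q : ℝ) (hq : 1 ≤ q) : Continuous (H q : E → (E →L[ℝ] E →L[ℝ] ℝ)) := by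
  unfold H
  have hc : Continuous (fun z : E => φ q z • L E) := (φ_cont (E := E) q hq).smul continuous_const
  refine hc.add ?_
  rw [continuous_iff_continuousAt]
  intro z
  by_cases hz : z = 0
  · subst hz
    have h0 : (ψ q (0 : E) • L E 0).smulRight (L E (0 : E)) = 0 := by simp
    unfold ContinuousAt
    beta_reduce
    rw [h0]
    refine squeeze_zero_norm (norm_T_le q hq) ?_
    have := (χ_cont (E := E) q hq).tendsto 0
    rwa [χ_zero] at this
  · have hne : s z - 1 ≠ 0 := (sub_pos.mpr (s_gt z hz)).ne'
    have hs : ContinuousAt (s : E → ℝ) z := s_cont.continuousAt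
    have hψ : ContinuousAt (ψ q : E → ℝ) z := by
      have a1 : ContinuousAt (fun z : E => (s z - 1) ^ (q - 2)) z :=
        (hs.sub continuousAt_const).rpow_const (Or.inl hne)
      have a2 : ContinuousAt (fun z : E => (s z - 1) ^ (q - 1)) z :=
        (rpow_cont q hq).continuousAt
      exact continuousAt_const.mul (((continuousAt_const.mul a1).div (hs.pow 2)
        (pow_pos (s_pos z) 2).ne').sub (a2.div (hs.pow 3) (pow_pos (s_pos z) 3).ne'))
    have hL : ContinuousAt (fun z : E => L E z) z := (L E).continuous.continuousAt
    have := (((ContinuousLinearMap.smulRightL ℝ E (E →L[ℝ] ℝ)).continuous.continuousAt).comp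
      (hψ.smul hL)).clm_apply hL
    exact this

lemma norm_H_le (q : ℝ) (hq : 1 ≤ q) (z : E) :
    ‖H q z‖ ≤ (2 * (q * (2 * q + 1))) * (1 + ‖z‖) ^ (q - 2) := by
  have h1 := s_pos z
  have h2 : 0 ≤ s z - 1 := by linarith [one_le_s z]
  have h3 : 0 ≤ q - 1 := by linarith
  have h4 : 0 ≤ q := by linarith
  set A := (s z - 1) ^ (q - 1) with hA
  have hA0 : 0 ≤ A := by positivity
  have hz : 0 < 1 + ‖z‖ := by positivity
  have hA1 : A ≤ (1 + ‖z‖) ^ (q - 1) :=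
    Real.rpow_le_rpow h2 (by linarith [s_le z]) h3
  have hB : (1 + ‖z‖) ^ (q - 1) = (1 + ‖z‖) ^ (q - 2) * (1 + ‖z‖) := by
    rw [← Real.rpow_add_one hz.ne']; congr 1; ring
  have hAs : A / s z ≤ 2 * (1 + ‖z‖) ^ (q - 2) := by
    rw [div_le_iff₀ h1]
    rw [hB] at hA1
    have : 0 ≤ (1 + ‖z‖) ^ (q - 2) := by positivity
    nlinarith [le_s z]
  have hφ : ‖φ q z • L E‖ ≤ q * (A / s z) := by
    refine (ContinuousLinearMap.opNorm_smul_le (φ q z) (L E)).trans ?_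
    have : ‖φ q z‖ = q * (A / s z) := by
      rw [Real.norm_of_nonneg (by unfold φ; positivity)]; unfold φ; rw [← hA]; ring
    rw [this]
    exact mul_le_of_le_one_right (by positivity) norm_L_le
  have hχ : χ q z ≤ q * (2 * q) * (A / s z) := by
    have e : χ q z = q * (A / s z) * ((q - 1) * ((s z + 1) / s z)
        + ((s z - 1) / s z) * ((s z + 1) / s z)) := by
      unfold χ; rw [← hA]; field_simp
    have b1 : (s z + 1) / s z ≤ 2 := by
      rw [div_le_iff₀ h1]; linarith
    have b2 : (s z - 1) / s z ≤ 1 := by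
      rw [div_le_iff₀ h1]; linarith
    have b3 : 0 ≤ (s z + 1) / s z := by positivity
    have b4 : 0 ≤ (s z - 1) / s z := by positivity
    rw [e]
    have : ((q - 1) * ((s z + 1) / s z) + ((s z - 1) / s z) * ((s z + 1) / s z)) ≤ 2 * q := by
      nlinarith [mul_le_mul_of_nonneg_left b1 h3, mul_le_mul b2 b1 b3 zero_le_one]
    calc _ ≤ q * (A / s z) * (2 * q) := by gcongr
      _ = _ := by ring
  calc ‖H q z‖ ≤ q * (A / s z) + q * (2 * q) * (A / s z) :=
        (norm_add_le (φ q z • L E) ((ψ q z • L E z).smulRight (L E z))).trans (add_le_add hφ ((norm_T_le q hq z).trans hχ))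
    _ = (q * (2 * q + 1)) * (A / s z) := by ring
    _ ≤ (q * (2 * q + 1)) * (2 * (1 + ‖z‖) ^ (q - 2)) := by gcongr
    _ = _ := by ring

end AngleQ

/-- Second-derivative upper bound (2.13) of the paper for `g(z) = ((1+‖z‖²)^(1/2) - 1)^q`:
`g` is `C²` and `‖D²g(z)‖ ≤ Λ_q (1+‖z‖)^(q-2)`. -/
theorem angle_q_second_deriv_upper
    (E : Type*) [NormedAddCommGroup E] [InnerProductSpace ℝ E] [FiniteDimensional ℝ E]
    (q : ℝ) (hq : 1 ≤ q) :
    ContDiff ℝ 2 (fun z : E => (Real.sqrt (1 + ‖z‖ ^ 2) - 1) ^ q) ∧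
    ∃ Λ : ℝ, 0 < Λ ∧ ∀ z : E,
      ‖iteratedFDeriv ℝ 2 (fun z : E => (Real.sqrt (1 + ‖z‖ ^ 2) - 1) ^ q) z‖
        ≤ Λ * (1 + ‖z‖) ^ (q - 2) := by
  have hg : fderiv ℝ (fun z : E => (Real.sqrt (1 + ‖z‖ ^ 2) - 1) ^ q)
      = fun z => AngleQ.φ q z • AngleQ.L E z :=
    funext fun z => (AngleQ.hasFDerivAt_g q hq z).fderiv
  have hG : fderiv ℝ (fun z : E => AngleQ.φ q z • AngleQ.L E z) = AngleQ.H q :=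
    funext fun z => (AngleQ.hasFDerivAt_G q hq z).fderiv
  refine ⟨?_, 2 * (q * (2 * q + 1)), by positivity, fun z => ?_⟩
  · rw [show (2 : WithTop ℕ∞) = 1 + 1 by norm_num, contDiff_succ_iff_fderiv]
    refine ⟨fun z => (AngleQ.hasFDerivAt_g q hq z).differentiableAt, by simp, ?_⟩
    rw [hg, contDiff_one_iff_fderiv, hG]
    exact ⟨fun z => (AngleQ.hasFDerivAt_G q hq z).differentiableAt, AngleQ.H_cont q hq⟩
  · rw [← norm_iteratedFDeriv_fderiv (n := 1), hg, norm_iteratedFDeriv_one, hG]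
    exact AngleQ.norm_H_le q hq z
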